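/- arXiv:2409.10592 — 3 statements merged into one kernel-verified Lean document; each statement's English description precedes it below -/
import Mathlib

section
/- The sum of f(a,b,c,d) = √(a²+b²) + √(c²+d²) − √((a+c)²+(b+d)²) over all integers a ≥ 1, b,c ≥ 0, d with ad − bc = 1 converges and equals 2. -/
/-- The triangle-inequality defect `f(a,b,c,d)`. -/
noncomputable def f (a b c d : ℤ) : ℝ :=
  Real.sqrt ((a : ℝ) ^ 2 + (b : ℝ) ^ 2) + Real.sqrt ((c : ℝ) ^ 2 + (d : ℝ) ^ 2) -
    Real.sqrt (((a : ℝ) + c) ^ 2 + ((b : ℝ) + d) ^ 2)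

namespace SLSum

/-- The index type. -/
abbrev X : Type := {x : ℤ × ℤ × ℤ × ℤ //
        1 ≤ x.1 ∧ 0 ≤ x.2.1 ∧ 0 ≤ x.2.2.1 ∧ x.1 * x.2.2.2 - x.2.1 * x.2.2.1 = 1}

def root : X := ⟨(1, 0, 0, 1), by norm_num⟩

/-- `(u, v) ↦ (u, u + v)`. -/
def cA (x : X) : X := ⟨(x.1.1, x.1.2.1, x.1.1 + x.1.2.2.1, x.1.2.1 + x.1.2.2.2), by
  obtain ⟨⟨a, b, c, d⟩, h1, h2, h3, h4⟩ := x
  dsimp only at h1 h2 h3 h4 ⊢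
  refine ⟨h1, h2, by omega, by linarith⟩⟩

/-- `(u, v) ↦ (u + v, v)`. -/
def cB (x : X) : X := ⟨(x.1.1 + x.1.2.2.1, x.1.2.1 + x.1.2.2.2, x.1.2.2.1, x.1.2.2.2), by
  obtain ⟨⟨a, b, c, d⟩, h1, h2, h3, h4⟩ := x
  dsimp only at h1 h2 h3 h4 ⊢
  have hd : 1 ≤ d := by nlinarith [mul_nonneg h2 h3]
  refine ⟨by omega, by omega, h3, by linarith⟩⟩

theorem d_pos (x : X) : 1 ≤ x.1.2.2.2 := by
  obtain ⟨⟨a, b, c, d⟩, h1, h2, h3, h4⟩ := x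
  simp only at *
  nlinarith [mul_nonneg h2 h3]

theorem cA_inj : Function.Injective cA := by
  rintro ⟨⟨a, b, c, d⟩, h⟩ ⟨⟨a', b', c', d'⟩, h'⟩ he
  simp only [cA, Subtype.mk.injEq, Prod.mk.injEq] at he ⊢
  omega

theorem cB_inj : Function.Injective cB := by
  rintro ⟨⟨a, b, c, d⟩, h⟩ ⟨⟨a', b', c', d'⟩, h'⟩ he
  simp only [cB, Subtype.mk.injEq, Prod.mk.injEq] at he ⊢
  omega

theorem cA_ne_cB (x y : X) : cA x ≠ cB y := by
  intro he
  have hx := x.2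
  have hy := y.2
  simp only [cA, cB, Subtype.mk.injEq, Prod.mk.injEq] at he
  omega

theorem cA_ne_root (x : X) : cA x ≠ root := by
  intro he
  have hx := x.2
  simp only [cA, root, Subtype.mk.injEq, Prod.mk.injEq] at he
  omega

theorem cB_ne_root (x : X) : cB x ≠ root := by
  intro he
  have hx := x.2
  have hd := d_pos x
  simp only [cB, root, Subtype.mk.injEq, Prod.mk.injEq] at he
  omega

def S : ℕ → Finset X
  | 0 => ∅
  | n + 1 => insert root ((S n).map ⟨cA, cA_inj⟩ ∪ (S n).map ⟨cB, cB_inj⟩)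

def T (F : X → ℝ) (x : X) : ℝ := F (cA x) + F (cB x)

theorem sum_S_succ (F : X → ℝ) (n : ℕ) :
    ∑ x ∈ S (n + 1), F x = F root + ∑ x ∈ S n, T F x := by
  rw [S, Finset.sum_insert, Finset.sum_union]
  · simp [T, Finset.sum_add_distrib]
  · rw [Finset.disjoint_left]
    intro z hz hz'
    simp only [Finset.mem_map, Function.Embedding.coeFn_mk] at hz hz'
    obtain ⟨x, -, rfl⟩ := hz
    obtain ⟨y, -, h⟩ := hz'
    exact cA_ne_cB x y h.symm
  · simp only [Finset.mem_union, Finset.mem_map, Function.Embedding.coeFn_mk]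
    rintro (⟨x, -, h⟩ | ⟨x, -, h⟩)
    · exact cA_ne_root x h
    · exact cB_ne_root x h

theorem S_mono : Monotone S := by
  refine monotone_nat_of_le_succ fun n => ?_
  induction n with
  | zero => simp [S]
  | succ n ih =>
    rw [S, S]
    exact Finset.insert_subset_insert _
      (Finset.union_subset_union (Finset.map_subset_map.2 ih) (Finset.map_subset_map.2 ih))

theorem S_exhaust (n : ℕ) : ∀ x : X, x.1.1 + x.1.2.1 + x.1.2.2.1 + x.1.2.2.2 ≤ n → x ∈ S n := by
  induction n with
  | zero =>
    intro x hx
    have := x.2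
    have := d_pos x
    push_cast at hx
    omega
  | succ n ih =>
    intro x hx
    have hd := d_pos x
    obtain ⟨⟨a, b, c, d⟩, h1, h2, h3, h4⟩ := x
    simp only at h1 h2 h3 h4 hx hd
    push_cast at hx
    rw [S]
    simp only [Finset.mem_insert, Finset.mem_union, Finset.mem_map, Function.Embedding.coeFn_mk]
    by_cases hca : a ≤ c
    · right; left
      refine ⟨⟨(a, b, c - a, d - b), h1, h2, by simp only; omega, by simp only; linarith⟩,
        ih _ ?_, ?_⟩
      · simp only; omega
      · simp [cA]
    · by_cases hbd : d ≤ b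
      · right; right
        refine ⟨⟨(a - c, b - d, c, d), by simp only; omega, by simp only; omega, h3,
          by simp only; linarith⟩, ih _ ?_, ?_⟩
        · simp only; omega
        · simp [cB]
      · left
        push Not at hca hbd
        have h5 : (c + 1) * (b + 1) ≤ a * d :=
          mul_le_mul (by omega) (by omega) (by omega) (by omega)
        have h6 : b + c ≤ 0 := by nlinarith
        have hb : b = 0 := by omega
        have hc : c = 0 := by omega
        subst hb hc
        have ha : a = 1 := by nlinarith
        subst ha
        have hd1 : d = 1 := by omega
        subst hd1
        rfl

theorem tendsto_S : Filter.Tendsto S Filter.atTop Filter.atTop := by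
  refine Filter.tendsto_atTop_finset_of_monotone S_mono fun x => ?_
  refine ⟨(x.1.1 + x.1.2.1 + x.1.2.2.1 + x.1.2.2.2).toNat, S_exhaust _ x ?_⟩
  exact Int.self_le_toNat _

theorem telescope (n : ℕ) : ∀ g : X → ℝ,
    ∑ x ∈ S n, (g x - T g x) = g root - T^[n] g root := by
  induction n with
  | zero => intro g; simp [S]
  | succ n ih =>
    intro g
    rw [sum_S_succ, Function.iterate_succ_apply]
    have := ih (T g)
    have e : ∀ x, T (fun y => g y - T g y) x = T g x - T (T g) x := by
      intro x; simp only [T]; ring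
    simp only [e, this]
    ring

noncomputable def p (x : X) : ℝ := (x.1.1 : ℝ) + x.1.2.1
noncomputable def q (x : X) : ℝ := (x.1.2.2.1 : ℝ) + x.1.2.2.2

theorem p_pos (x : X) : 0 < p x := by
  have := x.2
  unfold p
  have : 0 < x.1.1 + x.1.2.1 := by omega
  exact_mod_cast this

theorem q_pos (x : X) : 0 < q x := by
  have := x.2
  have := d_pos x
  unfold q
  have : 0 < x.1.2.2.1 + x.1.2.2.2 := by omega
  exact_mod_cast this

theorem p_cA (x : X) : p (cA x) = p x := rfl
theorem q_cA (x : X) : q (cA x) = p x + q x := by simp [p, q, cA]; ring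
theorem p_cB (x : X) : p (cB x) = p x + q x := by simp [p, q, cB]; ring
theorem q_cB (x : X) : q (cB x) = q x := rfl

def P (k : ℕ) (x : X) : Prop := q x ≤ (k + 1) * p x ∧ p x ≤ (k + 1) * q x

theorem P_cA {k : ℕ} {x : X} (h : P k x) : P (k + 1) (cA x) := by
  have := p_pos x
  have := q_pos x
  have hk : (0 : ℝ) ≤ k := k.cast_nonneg
  obtain ⟨h1, h2⟩ := h
  constructor <;> rw [p_cA, q_cA] <;> push_cast <;> nlinarith [mul_nonneg hk this.le]

theorem P_cB {k : ℕ} {x : X} (h : P k x) : P (k + 1) (cB x) := by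
  have h0 := p_pos x
  have := q_pos x
  have hk : (0 : ℝ) ≤ k := k.cast_nonneg
  obtain ⟨h1, h2⟩ := h
  constructor <;> rw [p_cB, q_cB] <;> push_cast <;> nlinarith [mul_nonneg hk this.le, mul_nonneg hk h0.le]

theorem T_mono (n : ℕ) : ∀ (k : ℕ) (F G : X → ℝ), (∀ x, P (k + n) x → F x ≤ G x) →
    ∀ x, P k x → T^[n] F x ≤ T^[n] G x := by
  induction n with
  | zero => intro k F G h x hx; exact h x hx
  | succ n ih =>
    intro k F G h x hx
    rw [Function.iterate_succ_apply', Function.iterate_succ_apply', T, T]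
    have h' : ∀ x, P (k + 1 + n) x → F x ≤ G x := by
      intro x hx; apply h; rwa [show k + (n + 1) = k + 1 + n by ring]
    exact add_le_add (ih (k + 1) F G h' _ (P_cA hx)) (ih (k + 1) F G h' _ (P_cB hx))

theorem T_smul (n : ℕ) (c : ℝ) (F : X → ℝ) : ∀ x, T^[n] (fun y => c * F y) x = c * T^[n] F x := by
  induction n with
  | zero => intro x; rfl
  | succ n ih =>
    intro x
    rw [Function.iterate_succ_apply', Function.iterate_succ_apply', T, T, ih, ih]
    ring

noncomputable def h (x : X) : ℝ := 1 / (p x * q x ^ 2) + 1 / (p x ^ 2 * q x)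

theorem P_root : P 0 root := by
  simp [P, p, q, root]

theorem T_h_le (n : ℕ) (x : X) (hx : P n x) : T h x ≤ ((n + 3 : ℝ) / (n + 4)) * h x := by
  have hp := p_pos x
  have hq := q_pos x
  obtain ⟨h1, h2⟩ := hx
  rw [T, h, h, h, p_cA, q_cA, p_cB, q_cB]
  generalize p x = p at *
  generalize q x = q at *
  have hn : (0 : ℝ) ≤ n := n.cast_nonneg
  generalize (n : ℝ) = m at *
  have e1 : 1 / (p * q ^ 2) + 1 / (p ^ 2 * q) = (p + q) / (p ^ 2 * q ^ 2) := by
    field_simp; try ring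
  have e2 : 1 / (p * (p + q) ^ 2) + 1 / (p ^ 2 * (p + q)) +
      (1 / ((p + q) * q ^ 2) + 1 / ((p + q) ^ 2 * q))
      = (p + q) / (p ^ 2 * q ^ 2) * (1 - p * q / (p + q) ^ 2) := by
    field_simp; ring
  rw [e1, e2, mul_comm]
  refine mul_le_mul_of_nonneg_right ?_ (by positivity)
  have key : 1 / (m + 4) ≤ p * q / (p + q) ^ 2 := by
    rw [div_le_div_iff₀ (by positivity) (by positivity)]
    nlinarith [mul_nonneg (sub_nonneg.2 h1) (sub_nonneg.2 h2), mul_pos hp hq,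
      mul_nonneg hn (mul_pos hp hq).le, mul_nonneg hp.le (sub_nonneg.2 h1),
      mul_nonneg hq.le (sub_nonneg.2 h2), mul_nonneg hp.le (sub_nonneg.2 h2),
      mul_nonneg hq.le (sub_nonneg.2 h1)]
  have : (m + 3) / (m + 4) = 1 - 1 / (m + 4) := by field_simp; ring
  linarith

theorem T_h_bound (n : ℕ) : T^[n] h root ≤ 6 / (n + 3) := by
  induction n with
  | zero => simp [h, p, q, root]; norm_num
  | succ n ih =>
    rw [Function.iterate_succ_apply]
    have h1 := T_mono n 0 (T h) (fun y => ((n + 3 : ℝ) / (n + 4)) * h y)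
      (fun x hx => T_h_le n x (by simpa using hx)) root P_root
    rw [T_smul] at h1
    refine h1.trans ((mul_le_mul_of_nonneg_left ih (by positivity)).trans (le_of_eq ?_))
    push_cast
    field_simp
    ring

noncomputable def U (x : X) : ℝ := Real.sqrt ((x.1.1 : ℝ) ^ 2 + (x.1.2.1 : ℝ) ^ 2)
noncomputable def V (x : X) : ℝ := Real.sqrt ((x.1.2.2.1 : ℝ) ^ 2 + (x.1.2.2.2 : ℝ) ^ 2)
noncomputable def s (x : X) : ℝ := (x.1.1 : ℝ) * x.1.2.2.1 + (x.1.2.1 : ℝ) * x.1.2.2.2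
noncomputable def W (x : X) : ℝ :=
  Real.sqrt (((x.1.1 : ℝ) + x.1.2.2.1) ^ 2 + ((x.1.2.1 : ℝ) + x.1.2.2.2) ^ 2)
noncomputable def g (x : X) : ℝ := (V x - s x / U x) + (U x - s x / V x)

theorem U_sq (x : X) : U x ^ 2 = (x.1.1 : ℝ) ^ 2 + (x.1.2.1 : ℝ) ^ 2 :=
  Real.sq_sqrt (by positivity)
theorem V_sq (x : X) : V x ^ 2 = (x.1.2.2.1 : ℝ) ^ 2 + (x.1.2.2.2 : ℝ) ^ 2 :=
  Real.sq_sqrt (by positivity)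
theorem W_sq (x : X) : W x ^ 2 = U x ^ 2 + V x ^ 2 + 2 * s x := by
  rw [U_sq, V_sq, W, Real.sq_sqrt (by positivity), s]; ring

theorem U_ge (x : X) : p x / 2 ≤ U x := by
  apply Real.le_sqrt_of_sq_le
  unfold p
  nlinarith [sq_nonneg ((x.1.1 : ℝ) - x.1.2.1), sq_nonneg ((x.1.1 : ℝ) + x.1.2.1)]
theorem V_ge (x : X) : q x / 2 ≤ V x := by
  apply Real.le_sqrt_of_sq_le
  unfold q
  nlinarith [sq_nonneg ((x.1.2.2.1 : ℝ) - x.1.2.2.2), sq_nonneg ((x.1.2.2.1 : ℝ) + x.1.2.2.2)]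

theorem U_pos (x : X) : 0 < U x := by linarith [U_ge x, p_pos x]
theorem V_pos (x : X) : 0 < V x := by linarith [V_ge x, q_pos x]

theorem s_nonneg (x : X) : 0 ≤ s x := by
  have h0 := x.2
  have hd := d_pos x
  have : 0 ≤ x.1.1 * x.1.2.2.1 + x.1.2.1 * x.1.2.2.2 :=
    add_nonneg (mul_nonneg (by omega) (by omega)) (mul_nonneg (by omega) (by omega))
  unfold s
  exact_mod_cast this

theorem UV_sq (x : X) : (U x * V x - s x) * (U x * V x + s x) = 1 := by
  have h0 : (x.1.1 : ℝ) * x.1.2.2.2 - x.1.2.1 * x.1.2.2.1 = 1 := by exact_mod_cast x.2.2.2.2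
  have : (U x * V x - s x) * (U x * V x + s x) = U x ^ 2 * V x ^ 2 - s x ^ 2 := by ring
  rw [this, U_sq, V_sq, s]
  calc _ = ((x.1.1 : ℝ) * x.1.2.2.2 - x.1.2.1 * x.1.2.2.1) ^ 2 := by ring
    _ = 1 := by rw [h0]; norm_num

theorem W_pos (x : X) : 0 < W x := by
  have h1 := W_sq x
  have h2 : 0 ≤ W x := Real.sqrt_nonneg _
  have := U_pos x
  have := s_nonneg x
  rcases h2.lt_or_eq with h | h
  · exact h
  · rw [← h] at h1
    nlinarith [pow_pos (U_pos x) 2, pow_pos (V_pos x) 2]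

theorem U_cA (x : X) : U (cA x) = U x := rfl
theorem V_cA (x : X) : V (cA x) = W x := by simp [V, W, cA]
theorem U_cB (x : X) : U (cB x) = W x := by simp [U, W, cB]
theorem V_cB (x : X) : V (cB x) = V x := rfl
theorem s_cA (x : X) : s (cA x) = U x ^ 2 + s x := by rw [U_sq]; simp [s, cA]; ring
theorem s_cB (x : X) : s (cB x) = V x ^ 2 + s x := by rw [V_sq]; simp [s, cB]; ring

theorem g_sub (x : X) : g x - T g x = U x + V x - W x := by
  have h1 := W_sq x
  have hU := U_pos x
  have hV := V_pos x
  have hW := W_pos x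
  rw [T, g, g, g, U_cA, V_cA, U_cB, V_cB, s_cA, s_cB]
  have e : (U x ^ 2 + s x) / W x + (V x ^ 2 + s x) / W x = W x := by
    rw [← add_div, div_eq_iff hW.ne']; nlinarith
  have e1 : (U x ^ 2 + s x) / U x = U x + s x / U x := by field_simp
  have e2 : (V x ^ 2 + s x) / V x = V x + s x / V x := by field_simp
  rw [e1, e2]
  linarith

theorem delta (x : X) : 0 ≤ U x * V x - s x ∧ U x * V x - s x ≤ 1 / (U x * V x) := by
  have h1 := UV_sq x
  have h2 := s_nonneg x
  have h3 := mul_pos (U_pos x) (V_pos x)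
  have h4 : 0 < U x * V x - s x := by
    by_contra hc
    push Not at hc
    nlinarith
  refine ⟨h4.le, ?_⟩
  rw [le_div_iff₀ h3]
  nlinarith

theorem g_nonneg (x : X) : 0 ≤ g x := by
  have hU := U_pos x
  have hV := V_pos x
  have hd := (delta x).1
  have e : g x = (U x * V x - s x) / U x + (U x * V x - s x) / V x := by
    rw [g]; field_simp
  rw [e]; positivity

theorem g_le (x : X) : g x ≤ 8 * h x := by
  have hU := U_pos x
  have hV := V_pos x
  have hp := p_pos x
  have hq := q_pos x
  have hd := (delta x).2
  have hUp := U_ge x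
  have hVq := V_ge x
  have e : g x = (U x * V x - s x) / U x + (U x * V x - s x) / V x := by
    rw [g]; field_simp
  have hd2 : 1 / (U x * V x) ≤ 1 / (p x / 2 * (q x / 2)) := by gcongr
  rw [e]
  calc _ ≤ 1 / (p x / 2 * (q x / 2)) / (p x / 2) + 1 / (p x / 2 * (q x / 2)) / (q x / 2) := by
        have := hd.trans hd2
        gcongr
    _ = 8 * h x := by rw [h]; field_simp; ring

theorem T_nonneg (n : ℕ) : ∀ x, 0 ≤ T^[n] g x := by
  induction n with
  | zero => exact g_nonneg
  | succ n ih =>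
    intro x
    rw [Function.iterate_succ_apply', T]
    exact add_nonneg (ih _) (ih _)

theorem T_g_tendsto : Filter.Tendsto (fun n => T^[n] g root) Filter.atTop (nhds 0) := by
  have hlim : Filter.Tendsto (fun n : ℕ => (48 : ℝ) / ((n : ℝ) + 3)) Filter.atTop (nhds 0) :=
    Filter.Tendsto.div_atTop tendsto_const_nhds
      (Filter.tendsto_atTop_add_const_right _ _ tendsto_natCast_atTop_atTop)
  refine squeeze_zero (fun n => T_nonneg n root) (fun n => ?_) hlim
  have h1 := T_mono n 0 g (fun y => 8 * h y) (fun x _ => g_le x) root P_root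
  rw [T_smul] at h1
  have h2 := T_h_bound n
  calc _ ≤ 8 * T^[n] h root := h1
    _ ≤ 8 * (6 / (n + 3)) := by linarith
    _ = _ := by ring

theorem g_root : g root = 2 := by
  simp [g, U, V, s, root]; norm_num

theorem F_nonneg (x : X) : 0 ≤ U x + V x - W x := by
  have h1 := W_sq x
  have h2 := (delta x).1
  have hU := U_pos x
  have hV := V_pos x
  have hW := W_pos x
  nlinarith

theorem main : HasSum (fun x : X => U x + V x - W x) 2 := by
  have hS : ∀ n, ∑ x ∈ S n, (U x + V x - W x) = 2 - T^[n] g root := by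
    intro n
    rw [← g_root, ← telescope]
    exact Finset.sum_congr rfl fun x _ => (g_sub x).symm
  have hsum : Summable (fun x : X => U x + V x - W x) := by
    refine summable_of_sum_le (c := 2) F_nonneg fun u => ?_
    obtain ⟨n, hn⟩ := (tendsto_S.eventually_ge_atTop u).exists
    have := Finset.sum_le_sum_of_subset_of_nonneg hn (fun x _ _ => F_nonneg x)
    rw [hS] at this
    linarith [T_nonneg n root]
  have h1 : Filter.Tendsto (fun n => ∑ x ∈ S n, (U x + V x - W x)) Filter.atTop (nhds _) :=
    hsum.hasSum.comp tendsto_S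
  have h2 : Filter.Tendsto (fun n => ∑ x ∈ S n, (U x + V x - W x)) Filter.atTop (nhds 2) := by
    simp only [hS]
    simpa using T_g_tendsto.const_sub 2
  rw [← tendsto_nhds_unique h1 h2]
  exact hsum.hasSum

end SLSum

theorem sum_f_eq_two :
    HasSum (fun x : {x : ℤ × ℤ × ℤ × ℤ //
        1 ≤ x.1 ∧ 0 ≤ x.2.1 ∧ 0 ≤ x.2.2.1 ∧ x.1 * x.2.2.2 - x.2.1 * x.2.2.1 = 1} =>
      f x.val.1 x.val.2.1 x.val.2.2.1 x.val.2.2.2) 2 := SLSum.main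
end

section
/- The sum over all a,b,c,d ∈ ℤ_{≥0} with a ≥ 1 and ad − bc = 1 of 4·(a·arctan(a/b) + c·arctan(c/d) − (a+c)·arctan((a+c)/(b+d)))² converges and equals π, where arctan(x/0) is interpreted as π/2. -/
open Real

/-- `a · arctan(a/b)`, interpreted as `a · π/2` when `b = 0`. -/
noncomputable def g (a b : ℕ) : ℝ :=
  if b = 0 then a * (π / 2) else a * Real.arctan ((a : ℝ) / b)

/-- The angle of the vector `(b, a)`. -/
noncomputable def th (a b : ℕ) : ℝ :=
  if b = 0 then π / 2 else Real.arctan ((a : ℝ) / b)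

lemma g_eq (a b : ℕ) : g a b = a * th a b := by
  unfold g th; split_ifs <;> rfl

/-- Nodes of the Stern-Brocot tree. -/
def node : List Bool → ℕ × ℕ × ℕ × ℕ
  | [] => (1, 0, 0, 1)
  | true :: l => ((node l).1, (node l).2.1, (node l).1 + (node l).2.2.1,
      (node l).2.1 + (node l).2.2.2)
  | false :: l => ((node l).1 + (node l).2.2.1, (node l).2.1 + (node l).2.2.2,
      (node l).2.2.1, (node l).2.2.2)

/-- Validity of a quadruple. -/
def Valid (x : ℕ × ℕ × ℕ × ℕ) : Prop := 1 ≤ x.1 ∧ x.1 * x.2.2.2 = x.2.1 * x.2.2.1 + 1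

lemma node_valid (l : List Bool) : Valid (node l) := by
  induction l with
  | nil => simp [node, Valid]
  | cons t l ih =>
    obtain ⟨h1, h2⟩ := ih
    cases t <;> refine ⟨by simp only [node]; omega, ?_⟩ <;> simp only [node] <;> nlinarith

lemma valid_pos_d {a b c d : ℕ} (h : a * d = b * c + 1) : 1 ≤ d := by
  rcases Nat.eq_zero_or_pos d with h0 | h0
  · subst h0; simp at h
  · exact h0

lemma node_surj : ∀ (n a b c d : ℕ), a + b + c + d ≤ n → 1 ≤ a → a * d = b * c + 1 →
    ∃ l, node l = (a, b, c, d) := by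
  intro n
  induction n with
  | zero => intro a b c d h h1; omega
  | succ n ih =>
    intro a b c d h h1 h2
    have hd := valid_pos_d h2
    by_cases hac : a ≤ c
    · have hbd : b ≤ d := by
        by_contra hlt
        push Not at hlt
        nlinarith
      obtain ⟨c', rfl⟩ := Nat.exists_eq_add_of_le hac
      obtain ⟨d', rfl⟩ := Nat.exists_eq_add_of_le hbd
      obtain ⟨l, hl⟩ := ih a b c' d' (by omega) h1 (by nlinarith)
      exact ⟨true :: l, by simp [node, hl]⟩
    · push Not at hac
      by_cases hbd : d ≤ b
      · obtain ⟨a', rfl⟩ := Nat.exists_eq_add_of_le hac.le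
        obtain ⟨b', rfl⟩ := Nat.exists_eq_add_of_le hbd
        obtain ⟨l, hl⟩ := ih a' b' c d (by omega) (by omega) (by nlinarith)
        exact ⟨false :: l, by simp [node, hl, add_comm]⟩
      · push Not at hbd
        obtain ⟨a', rfl⟩ := Nat.exists_eq_add_of_lt hac
        obtain ⟨d', rfl⟩ := Nat.exists_eq_add_of_lt hbd
        have e : c + a' + b + d' + c * d' + a' * b + a' * d' = 0 := by nlinarith
        have : c = 0 ∧ a' = 0 ∧ b = 0 ∧ d' = 0 := by omega
        obtain ⟨rfl, rfl, rfl, rfl⟩ := this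
        exact ⟨[], by simp [node]⟩

lemma node_inj : ∀ l m : List Bool, node l = node m → l = m := by
  intro l
  induction l with
  | nil =>
    intro m h
    cases m with
    | nil => rfl
    | cons t m =>
      exfalso
      obtain ⟨h1, h2⟩ := node_valid m
      have hd := valid_pos_d h2
      cases t <;> simp only [node, Prod.mk.injEq] at h <;> omega
  | cons s l ih =>
    intro m h
    obtain ⟨k1, k2⟩ := node_valid l
    have kd := valid_pos_d k2
    cases m with
    | nil =>
      exfalso
      cases s <;> simp only [node, Prod.mk.injEq] at h <;> omega
    | cons t m =>
      obtain ⟨h1, h2⟩ := node_valid m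
      have hd := valid_pos_d h2
      cases s <;> cases t <;> simp only [node, Prod.mk.injEq] at h
      · congr 1
        apply ih
        ext <;> omega
      · omega
      · omega
      · congr 1
        apply ih
        ext <;> omega

/-- Words of length `n`. -/
def W : ℕ → Finset (List Bool)
  | 0 => {[]}
  | n + 1 => (W n).image (List.cons true) ∪ (W n).image (List.cons false)

lemma mem_W (n : ℕ) (l : List Bool) : l ∈ W n ↔ l.length = n := by
  induction n generalizing l with
  | zero => simp [W]
  | succ n ih =>
    cases l with
    | nil => simp [W]
    | cons t l => cases t <;> simp [W, ih]

lemma sum_W (n : ℕ) (F : List Bool → ℝ) :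
    ∑ l ∈ W (n + 1), F l = ∑ l ∈ W n, (F (true :: l) + F (false :: l)) := by
  rw [W, Finset.sum_union, Finset.sum_image, Finset.sum_image, Finset.sum_add_distrib]
  · intro x _ y _ h; simpa using h
  · intro x _ y _ h; simpa using h
  · rw [Finset.disjoint_left]
    intro x hx hy
    simp only [Finset.mem_image] at hx hy
    obtain ⟨y, _, rfl⟩ := hx
    obtain ⟨z, _, h⟩ := hy
    simp at h

/-- Words of length less than `n`. -/
def V : ℕ → Finset (List Bool)
  | 0 => ∅
  | n + 1 => V n ∪ W n

lemma mem_V (n : ℕ) (l : List Bool) : l ∈ V n ↔ l.length < n := by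
  induction n with
  | zero => simp [V]
  | succ n ih => simp only [V, Finset.mem_union, ih, mem_W]; omega

lemma sum_V (n : ℕ) (F : List Bool → ℝ) :
    ∑ l ∈ V (n + 1), F l = ∑ l ∈ V n, F l + ∑ l ∈ W n, F l := by
  rw [V, Finset.sum_union]
  rw [Finset.disjoint_left]
  intro x hx hy
  rw [mem_V] at hx
  rw [mem_W] at hy
  omega

/-- Angle of a cone. -/
noncomputable def ang (x : ℕ × ℕ × ℕ × ℕ) : ℝ := th x.1 x.2.1 - th x.2.2.1 x.2.2.2

/-- Half of the sine of the double angle. -/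
noncomputable def sn (a b : ℕ) : ℝ := (a * b : ℝ) / ((a : ℝ) ^ 2 + (b : ℝ) ^ 2)

/-- Twice the area of a corner. -/
noncomputable def B (x : ℕ × ℕ × ℕ × ℕ) : ℝ :=
  -((x.1 : ℝ) * x.2.2.1) * ang x ^ 2 + ang x / 2 - (sn x.1 x.2.1 - sn x.2.2.1 x.2.2.2) / 2

/-- The square defect. -/
noncomputable def D (x : ℕ × ℕ × ℕ × ℕ) : ℝ :=
  (g x.1 x.2.1 + g x.2.2.1 x.2.2.2 - g (x.1 + x.2.2.1) (x.2.1 + x.2.2.2)) ^ 2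

lemma ang_split (l : List Bool) :
    ang (node (true :: l)) + ang (node (false :: l)) = ang (node l) := by
  simp only [node, ang]; ring

lemma B_split (l : List Bool) :
    B (node (true :: l)) + B (node (false :: l)) = B (node l) - D (node l) := by
  simp only [node, ang, B, D, g_eq]; push_cast; ring

lemma sum_ang (n : ℕ) : ∑ l ∈ W n, ang (node l) = π / 2 := by
  induction n with
  | zero => simp [W, node, ang, th]
  | succ n ih => rw [sum_W, ← ih]; exact Finset.sum_congr rfl fun l _ => ang_split l

lemma sum_D (n : ℕ) : ∑ l ∈ V n, D (node l) = π / 4 - ∑ l ∈ W n, B (node l) := by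
  induction n with
  | zero => simp [V, W, node, ang, th, B, sn]; ring
  | succ n ih =>
    rw [sum_V, ih, sum_W, Finset.sum_congr rfl fun l _ => B_split l, Finset.sum_sub_distrib]
    ring

/-- The inner product. -/
def ip (x : ℕ × ℕ × ℕ × ℕ) : ℕ := x.1 * x.2.2.1 + x.2.1 * x.2.2.2

lemma ip_ge (l : List Bool) : l.length ≤ ip (node l) := by
  induction l with
  | nil => simp
  | cons t l ih =>
    obtain ⟨h1, h2⟩ := node_valid l
    have hd := valid_pos_d h2
    cases t <;> simp only [List.length_cons, node, ip] at * <;> nlinarith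

lemma ang_eq (x : ℕ × ℕ × ℕ × ℕ) (h : Valid x) (hp : 0 < ip x) :
    ang x = Real.arctan ((ip x : ℝ)⁻¹) := by
  obtain ⟨a, b, c, d⟩ := x
  obtain ⟨h1, h2⟩ := h
  simp only [ang, ip] at *
  have hd := valid_pos_d h2
  have ha' : (0 : ℝ) < a := by exact_mod_cast h1
  have hd' : (0 : ℝ) < d := by exact_mod_cast hd
  have h2' : (a * d : ℝ) = b * c + 1 := by exact_mod_cast h2
  have e1 : th a b = π / 2 - Real.arctan ((b : ℝ) / a) := by
    unfold th
    split_ifs with hb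
    · simp [hb]
    · have hb' : (0 : ℝ) < b := by exact_mod_cast Nat.pos_of_ne_zero hb
      rw [← Real.arctan_inv_of_pos (by positivity), inv_div]
  have e2 : th c d = Real.arctan ((c : ℝ) / d) := by
    unfold th
    rw [if_neg (by omega)]
  have hp' : (0 : ℝ) < ((a * c + b * d : ℕ) : ℝ) := by exact_mod_cast hp
  have hlt : (b : ℝ) / a * (c / d) < 1 := by
    rw [div_mul_div_comm, div_lt_one (by positivity)]
    linarith
  rw [Real.arctan_inv_of_pos hp', e1, e2, sub_sub, Real.arctan_add hlt]
  congr 2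
  push_cast
  rw [div_eq_iff (by linarith)]
  field_simp
  rw [h2']
  ring

lemma arctan_lower {x : ℝ} (hx : 0 ≤ x) : x / (1 + x ^ 2) ≤ Real.arctan x := by
  have h := Real.sin_le (x := 2 * Real.arctan x) (by have := Real.arctan_nonneg.2 hx; linarith)
  rw [Real.sin_two_mul, mul_assoc, Real.sin_arctan, Real.cos_arctan] at h
  have e : x / √(1 + x ^ 2) * (1 / √(1 + x ^ 2)) = x / (1 + x ^ 2) := by
    rw [div_mul_div_comm, Real.mul_self_sqrt (by positivity), mul_one]
  rw [e] at h
  linarith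

lemma arctan_upper {x : ℝ} (hx : 0 ≤ x) : Real.arctan x ≤ x := by
  have h := Real.le_tan (Real.arctan_nonneg.2 hx) (Real.arctan_lt_pi_div_two x)
  rwa [Real.tan_arctan] at h

lemma B_bound (x : ℕ × ℕ × ℕ × ℕ) (h : Valid x) (hp : 0 < ip x) :
    |B x| ≤ 2 / (ip x) * ang x := by
  have hA := ang_eq x h hp
  have hP : (1 : ℝ) ≤ ip x := by exact_mod_cast hp
  have hl := arctan_lower (x := (ip x : ℝ)⁻¹) (by positivity)
  have hu := arctan_upper (x := (ip x : ℝ)⁻¹) (by positivity)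
  rw [← hA] at hl hu
  unfold B
  generalize ang x = t at *
  obtain ⟨a, b, c, d⟩ := x
  obtain ⟨h1, h2⟩ := h
  have hpe : ((ip (a, b, c, d) : ℕ) : ℝ) = a * c + b * d := by simp [ip]
  generalize ((ip (a, b, c, d) : ℕ) : ℝ) = p at *
  simp only at *
  have hd := valid_pos_d h2
  have ha' : (0 : ℝ) < a := by exact_mod_cast h1
  have hd' : (0 : ℝ) < d := by exact_mod_cast hd
  have h2' : (a * d : ℝ) = b * c + 1 := by exact_mod_cast h2
  have hb' : (0 : ℝ) ≤ b := by positivity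
  have hc' : (0 : ℝ) ≤ c := by positivity
  have hNM : ((a : ℝ) ^ 2 + b ^ 2) * ((c : ℝ) ^ 2 + d ^ 2) = p ^ 2 + 1 := by
    have : (a * d - b * c : ℝ) ^ 2 = 1 := by rw [h2']; ring
    rw [hpe]; linarith
  have hsn : sn a b - sn c d = (p - 2 * (a * c)) / (p ^ 2 + 1) := by
    unfold sn
    rw [← hNM, div_sub_div _ _ (by positivity) (by positivity)]
    congr 1
    have : (a * d - b * c : ℝ) = 1 := by rw [h2']; ring
    rw [hpe]
    linear_combination (b * d - a * c : ℝ) * this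
  rw [hsn]
  have hk0 : (0 : ℝ) ≤ a * c := by positivity
  have hk1 : (a * c : ℝ) ≤ p := by rw [hpe]; nlinarith
  generalize (a * c : ℝ) = k at *
  have hp0 : 0 < p := by linarith
  have hl' : p / (p ^ 2 + 1) ≤ t := by
    convert hl using 1
    field_simp
  have hq : 0 < p ^ 2 + 1 := by positivity
  have ht : 0 < t := lt_of_lt_of_le (by positivity) hl'
  have s1 : t - p / (p ^ 2 + 1) ≤ t / p := by
    have : p⁻¹ - p / (p ^ 2 + 1) = (p / (p ^ 2 + 1)) / p * p⁻¹ := by field_simp; ring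
    have h3 : (p / (p ^ 2 + 1)) / p * p⁻¹ ≤ t / p * 1 := by
      gcongr
      exact inv_le_one_of_one_le₀ hP
    linarith
  have s2 : k * (t ^ 2 - 1 / (p ^ 2 + 1)) ≤ t / p := by
    have h3 : t ^ 2 ≤ p⁻¹ ^ 2 := by gcongr
    have h4 : p * (p⁻¹ ^ 2 - 1 / (p ^ 2 + 1)) = (p / (p ^ 2 + 1)) / p * p⁻¹ := by
      field_simp; ring
    have h5 : (p / (p ^ 2 + 1)) / p * p⁻¹ ≤ t / p * 1 := by
      gcongr
      exact inv_le_one_of_one_le₀ hP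
    have h6 : 0 ≤ p⁻¹ ^ 2 - 1 / (p ^ 2 + 1) := by
      have : p⁻¹ ^ 2 - 1 / (p ^ 2 + 1) = 1 / (p ^ 2 * (p ^ 2 + 1)) := by field_simp; ring
      rw [this]; positivity
    calc k * (t ^ 2 - 1 / (p ^ 2 + 1)) ≤ k * (p⁻¹ ^ 2 - 1 / (p ^ 2 + 1)) := by gcongr
      _ ≤ p * (p⁻¹ ^ 2 - 1 / (p ^ 2 + 1)) := by gcongr
      _ ≤ t / p := by linarith
  have s3 : -(t / p) ≤ k * (t ^ 2 - 1 / (p ^ 2 + 1)) := by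
    have h3 : (p / (p ^ 2 + 1)) ^ 2 ≤ t ^ 2 := by gcongr
    have h4 : 1 / (p ^ 2 + 1) - (p / (p ^ 2 + 1)) ^ 2 = 1 / (p ^ 2 + 1) ^ 2 := by
      field_simp; ring
    have h5 : p * (1 / (p ^ 2 + 1) ^ 2) ≤ t / p := by
      rw [le_div_iff₀ hp0]
      refine le_trans ?_ hl'
      have : p * (1 / (p ^ 2 + 1) ^ 2) * p = p / (p ^ 2 + 1) * (p / (p ^ 2 + 1)) := by
        field_simp
      rw [this]
      apply mul_le_of_le_one_right (by positivity)
      rw [div_le_one hq]; nlinarith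
    have h6 : k * (1 / (p ^ 2 + 1) ^ 2) ≤ p * (1 / (p ^ 2 + 1) ^ 2) := by gcongr
    have h7 : k * (-(1 / (p ^ 2 + 1) ^ 2)) ≤ k * (t ^ 2 - 1 / (p ^ 2 + 1)) := by
      gcongr; linarith
    linarith
  have e : -k * t ^ 2 + t / 2 - (p - 2 * k) / (p ^ 2 + 1) / 2 =
      (t - p / (p ^ 2 + 1)) / 2 - k * (t ^ 2 - 1 / (p ^ 2 + 1)) := by
    field_simp; ring
  have e2 : 2 / p * t = 2 * (t / p) := by ring
  have htp : 0 < t / p := by positivity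
  rw [e, e2, abs_le]
  constructor <;> linarith

lemma sum_B_bound (n : ℕ) : |∑ l ∈ W (n + 1), B (node l)| ≤ π / ((n : ℝ) + 1) := by
  calc |∑ l ∈ W (n + 1), B (node l)| ≤ ∑ l ∈ W (n + 1), |B (node l)| :=
        Finset.abs_sum_le_sum_abs _ _
    _ ≤ ∑ l ∈ W (n + 1), 2 / ((n : ℝ) + 1) * ang (node l) := by
        apply Finset.sum_le_sum
        intro l hl
        rw [mem_W] at hl
        have h1 := ip_ge l
        rw [hl] at h1
        have h2 : (n : ℝ) + 1 ≤ ip (node l) := by exact_mod_cast h1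
        have h0 : 0 < ip (node l) := by omega
        refine (B_bound _ (node_valid l) h0).trans ?_
        have : 0 ≤ ang (node l) := by
          rw [ang_eq _ (node_valid l) h0]
          exact Real.arctan_nonneg.2 (by positivity)
        gcongr
    _ = π / ((n : ℝ) + 1) := by
        rw [← Finset.mul_sum, sum_ang]; ring

lemma tendsto_D : Filter.Tendsto (fun n => ∑ l ∈ V (n + 1), D (node l)) Filter.atTop
    (nhds (π / 4)) := by
  have h : Filter.Tendsto (fun n => ∑ l ∈ W (n + 1), B (node l)) Filter.atTop (nhds 0) := by
    apply squeeze_zero_norm (a := fun n : ℕ => π * (1 / ((n : ℝ) + 1)))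
    · intro n
      rw [Real.norm_eq_abs, mul_one_div]
      exact sum_B_bound n
    · simpa using tendsto_one_div_add_atTop_nhds_zero_nat.const_mul π
  simp_rw [sum_D]
  simpa using h.const_sub (π / 4)

lemma hasSum_D : HasSum (fun l => D (node l)) (π / 4) := by
  have hD : ∀ l, 0 ≤ D (node l) := fun l => sq_nonneg _
  have hV : Monotone (fun n => V (n + 1)) := by
    intro m n h l
    simp only [mem_V]
    omega
  have hV' : Filter.Tendsto (fun n => V (n + 1)) Filter.atTop Filter.atTop :=
    Filter.tendsto_atTop_finset_of_monotone hV fun l => ⟨l.length, by rw [mem_V]; omega⟩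
  have hm : Monotone (fun n => ∑ l ∈ V (n + 1), D (node l)) := fun m n h =>
    Finset.sum_le_sum_of_subset_of_nonneg (hV h) fun l _ _ => hD l
  have hs : Summable (fun l => D (node l)) := by
    apply summable_of_sum_le hD (c := π / 4)
    intro s
    obtain ⟨n, hn⟩ := (hV'.eventually (Filter.eventually_ge_atTop s)).exists
    exact (Finset.sum_le_sum_of_subset_of_nonneg hn fun l _ _ => hD l).trans
      (hm.ge_of_tendsto tendsto_D n)
  have := tendsto_nhds_unique (hs.hasSum.comp hV') tendsto_D
  rw [← this]
  exact hs.hasSum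

/-- Words enumerate the quadruples. -/
noncomputable def nodeEquiv : List Bool ≃ {x : ℕ × ℕ × ℕ × ℕ //
        1 ≤ x.1 ∧ x.1 * x.2.2.2 = x.2.1 * x.2.2.1 + 1} :=
  Equiv.ofBijective (fun l => ⟨node l, node_valid l⟩) ⟨fun l m h => node_inj l m (congrArg Subtype.val h),
    fun ⟨⟨a, b, c, d⟩, h1, h2⟩ => by
      obtain ⟨l, hl⟩ := node_surj _ a b c d le_rfl h1 h2
      exact ⟨l, Subtype.ext hl⟩⟩

theorem sum_cycloid_sq_eq_pi :
    HasSum (fun x : {x : ℕ × ℕ × ℕ × ℕ //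
        1 ≤ x.1 ∧ x.1 * x.2.2.2 = x.2.1 * x.2.2.1 + 1} =>
      4 * (g x.val.1 x.val.2.1 + g x.val.2.2.1 x.val.2.2.2 -
        g (x.val.1 + x.val.2.2.1) (x.val.2.1 + x.val.2.2.2)) ^ 2) π := by
  rw [← nodeEquiv.hasSum_iff]
  have h := hasSum_D.mul_left 4
  rw [mul_div_cancel₀ π (by norm_num : (4 : ℝ) ≠ 0)] at h
  exact h
end

section
/- The sum over all a,b,c,d ∈ ℤ_{≥0} with a ≥ 1 and ad − bc = 1 of (ab/√(a²+b²) + cd/√(c²+d²) − (a+c)(b+d)/√((a+c)²+(b+d)²)) converges and equals −2. -/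
/-- The astroid support value `ab/√(a²+b²)`. -/
noncomputable def h (a b : ℕ) : ℝ := (a : ℝ) * b / Real.sqrt ((a : ℝ) ^ 2 + (b : ℝ) ^ 2)

namespace Astroid

/-- Index type: matrices in SL2 with nonnegative entries. -/
abbrev X : Type := {x : ℕ × ℕ × ℕ × ℕ // 1 ≤ x.1 ∧ x.1 * x.2.2.2 = x.2.1 * x.2.2.1 + 1}

def I : X := ⟨(1, 0, 0, 1), by simp⟩

def L (x : X) : X := ⟨(x.1.1, x.1.2.1, x.1.1 + x.1.2.2.1, x.1.2.1 + x.1.2.2.2), by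
  obtain ⟨⟨a, b, c, d⟩, h1, h2⟩ := x
  simp only at *
  refine ⟨h1, by nlinarith⟩⟩

def R (x : X) : X := ⟨(x.1.1 + x.1.2.2.1, x.1.2.1 + x.1.2.2.2, x.1.2.2.1, x.1.2.2.2), by
  obtain ⟨⟨a, b, c, d⟩, h1, h2⟩ := x
  simp only at *
  refine ⟨by omega, by nlinarith⟩⟩

def s (x : X) : ℕ := x.1.1 + x.1.2.1
def t (x : X) : ℕ := x.1.2.2.1 + x.1.2.2.2

lemma s_pos (x : X) : 1 ≤ s x := by
  have := x.2.1
  unfold s; omega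

lemma t_pos (x : X) : 1 ≤ t x := by
  obtain ⟨⟨a, b, c, d⟩, h1, h2⟩ := x
  simp only [t] at *
  rcases Nat.eq_zero_or_pos d with h | h
  · subst h; simp at h2
  · omega

lemma L_inj : Function.Injective L := by
  rintro ⟨⟨a, b, c, d⟩, h1, h2⟩ ⟨⟨a', b', c', d'⟩, h1', h2'⟩ hh
  simp only [L, Subtype.mk.injEq, Prod.mk.injEq] at hh ⊢
  omega

lemma R_inj : Function.Injective R := by
  rintro ⟨⟨a, b, c, d⟩, h1, h2⟩ ⟨⟨a', b', c', d'⟩, h1', h2'⟩ hh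
  simp only [R, Subtype.mk.injEq, Prod.mk.injEq] at hh ⊢
  omega

lemma L_ne_R (x y : X) : L x ≠ R y := by
  intro hh
  have h1 : s (L x) = s (R y) := by rw [hh]
  have h2 : t (L x) = t (R y) := by rw [hh]
  have := t_pos x
  have := s_pos y
  have e1 : s (L x) = s x := rfl
  have e2 : t (L x) = s x + t x := by simp only [s, t, L]; omega
  have e3 : s (R y) = s y + t y := by simp only [s, t, R]; omega
  have e4 : t (R y) = t y := rfl
  omega

lemma sL (x : X) : s (L x) = s x := rfl
lemma tL (x : X) : t (L x) = s x + t x := by simp only [s, t, L]; omega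
lemma sR (x : X) : s (R x) = s x + t x := by simp only [s, t, R]; omega
lemma tR (x : X) : t (R x) = t x := rfl

lemma L_ne_I (x : X) : L x ≠ I := by
  intro hh
  have h1 : s (L x) = s I := by rw [hh]
  have h2 : t (L x) = t I := by rw [hh]
  have := t_pos x
  have := s_pos x
  rw [sL] at h1
  rw [tL] at h2
  have e1 : s I = 1 := rfl
  have e2 : t I = 1 := rfl
  omega

lemma R_ne_I (x : X) : R x ≠ I := by
  intro hh
  have h1 : s (R x) = s I := by rw [hh]
  have h2 : t (R x) = t I := by rw [hh]
  have := t_pos x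
  have := s_pos x
  rw [sR] at h1
  rw [tR] at h2
  have e1 : s I = 1 := rfl
  have e2 : t I = 1 := rfl
  omega

lemma cases_X (x : X) : x = I ∨ (∃ y, x = L y) ∨ (∃ y, x = R y) := by
  obtain ⟨⟨a, b, c, d⟩, h1, h2⟩ := x
  simp only at h1 h2
  by_cases hL : a ≤ c ∧ b ≤ d
  · right; left
    obtain ⟨⟨c', rfl⟩, ⟨d', rfl⟩⟩ := And.intro (Nat.exists_eq_add_of_le hL.1)
      (Nat.exists_eq_add_of_le hL.2)
    exact ⟨⟨(a, b, c', d'), h1, by simp only; nlinarith⟩, rfl⟩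
  by_cases hR : c ≤ a ∧ d ≤ b
  · right; right
    obtain ⟨⟨a', rfl⟩, ⟨b', rfl⟩⟩ := And.intro (Nat.exists_eq_add_of_le hR.1)
      (Nat.exists_eq_add_of_le hR.2)
    have h3 : a' * d = b' * c + 1 := by nlinarith
    have h4 : 1 ≤ a' := by
      rcases Nat.eq_zero_or_pos a' with h | h
      · subst h; omega
      · exact h
    refine ⟨⟨(a', b', c, d), h4, h3⟩, ?_⟩
    simp only [R, Subtype.mk.injEq, Prod.mk.injEq, and_true]
    exact ⟨Nat.add_comm _ _, Nat.add_comm _ _⟩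
  left
  have hac : c < a ∧ b < d ∨ (a < c ∧ d < b) := by omega
  rcases hac with ⟨h3, h4⟩ | ⟨h3, h4⟩
  · obtain ⟨a', rfl⟩ := Nat.exists_eq_add_of_lt h3
    obtain ⟨d', rfl⟩ := Nat.exists_eq_add_of_lt h4
    have e : a' * b + a' * d' + a' + b + d' + c * d' + c = 0 := by nlinarith
    have : a' = 0 ∧ b = 0 ∧ d' = 0 ∧ c = 0 := by
      refine ⟨?_, ?_, ?_, ?_⟩ <;> 
        · have := Nat.zero_le (a' * b)
          have := Nat.zero_le (a' * d')
          have := Nat.zero_le (c * d')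
          omega
    obtain ⟨rfl, rfl, rfl, rfl⟩ := this
    rfl
  · exfalso
    have := Nat.mul_le_mul h3.le h4.le
    nlinarith

open Classical in
/-- Nodes of depth below `n`. -/
noncomputable def S : ℕ → Finset X
  | 0 => ∅
  | n + 1 => insert I ((S n).image L ∪ (S n).image R)

lemma sum_S (F : X → ℝ) (n : ℕ) :
    ∑ x ∈ S (n + 1), F x = F I + ∑ x ∈ S n, (F (L x) + F (R x)) := by
  classical
  rw [S, Finset.sum_insert, Finset.sum_union, Finset.sum_image, Finset.sum_image,
    Finset.sum_add_distrib]
  · exact fun _ _ _ _ h => R_inj h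
  · exact fun _ _ _ _ h => L_inj h
  · rw [Finset.disjoint_left]
    intro x hx hy
    simp only [Finset.mem_image] at hx hy
    obtain ⟨y, _, rfl⟩ := hx
    obtain ⟨z, _, hz⟩ := hy
    exact L_ne_R _ _ hz.symm
  · simp only [Finset.mem_union, Finset.mem_image, not_or, not_exists, not_and]
    exact ⟨fun x _ => L_ne_I x, fun x _ => R_ne_I x⟩

lemma S_step (n : ℕ) : S n ⊆ S (n + 1) := by
  classical
  induction n with
  | zero => simp [S]
  | succ n ih =>
    rw [S, S.eq_2 (n + 1)]
    exact Finset.insert_subset_insert _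
      (Finset.union_subset_union (Finset.image_subset_image ih) (Finset.image_subset_image ih))

lemma S_mono : Monotone S := monotone_nat_of_le_succ S_step

lemma S_cover (n : ℕ) : ∀ x : X, s x + t x < n + 2 → x ∈ S n := by
  classical
  induction n with
  | zero =>
    intro x hx
    have := s_pos x
    have := t_pos x
    omega
  | succ n ih =>
    intro x hx
    rcases cases_X x with rfl | ⟨y, rfl⟩ | ⟨y, rfl⟩
    · simp [S]
    · rw [sL, tL] at hx
      have := s_pos y
      have : y ∈ S n := ih y (by omega)
      simp only [S, Finset.mem_insert, Finset.mem_union, Finset.mem_image]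
      exact Or.inr (Or.inl ⟨y, this, rfl⟩)
    · rw [sR, tR] at hx
      have := t_pos y
      have : y ∈ S n := ih y (by omega)
      simp only [S, Finset.mem_insert, Finset.mem_union, Finset.mem_image]
      exact Or.inr (Or.inr ⟨y, this, rfl⟩)

lemma S_tendsto : Filter.Tendsto S Filter.atTop Filter.atTop :=
  Filter.tendsto_atTop_finset_of_monotone S_mono
    fun x => ⟨s x + t x, S_cover _ x (by omega)⟩

/-- Transfer operator. -/
def T (n : ℕ) (F : X → ℝ) : X → ℝ := match n with
  | 0 => F
  | n + 1 => fun x => T n F (L x) + T n F (R x)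

lemma T_succ' (n : ℕ) (F : X → ℝ) : T n (fun x => F (L x) + F (R x)) = T (n + 1) F := by
  induction n with
  | zero => rfl
  | succ n ih =>
    funext x
    change T n _ (L x) + T n _ (R x) = T (n+1) F (L x) + T (n+1) F (R x)
    rw [ih]

lemma telescope (n : ℕ) : ∀ F : X → ℝ,
    ∑ x ∈ S n, (F x - (F (L x) + F (R x))) = F I - T n F I := by
  induction n with
  | zero => intro F; simp [S, T]
  | succ n ih =>
    intro F
    have := ih (fun x => F (L x) + F (R x))
    rw [T_succ'] at this
    rw [sum_S (fun x => F x - (F (L x) + F (R x)))]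
    have e : ∑ x ∈ S n, ((F (L x) - (F (L (L x)) + F (R (L x)))) +
        (F (R x) - (F (L (R x)) + F (R (R x))))) = 
        ∑ x ∈ S n, (F (L x) + F (R x) - (F (L (L x)) + F (R (L x)) +
          (F (L (R x)) + F (R (R x))))) := by
      refine Finset.sum_congr rfl fun x _ => by ring
    rw [e, this]; ring

noncomputable def g (s t : ℝ) : ℝ := 1 / (s ^ 2 * t) + 1 / (s * t ^ 2)

noncomputable def G : ℕ → ℝ → ℝ → ℝ
  | 0 => g
  | n + 1 => fun s t => G n s (s + t) + G n (s + t) t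

lemma g_step {s t : ℝ} (hs : 0 < s) (ht : 0 < t) :
    g s t - (g s (s + t) + g (s + t) t) = 1 / (s * t * (s + t)) := by
  unfold g
  field_simp
  ring

lemma G_nonneg (n : ℕ) : ∀ {s t : ℝ}, 0 < s → 0 < t → 0 ≤ G n s t := by
  induction n with
  | zero => intro s t hs ht; unfold G g; positivity
  | succ n ih =>
    intro s t hs ht
    exact add_nonneg (ih hs (by positivity)) (ih (by positivity) ht)

lemma G_anti_step (n : ℕ) : ∀ {s t : ℝ}, 0 < s → 0 < t → G (n + 1) s t ≤ G n s t := by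
  induction n with
  | zero =>
    intro s t hs ht
    have := g_step hs ht
    have h2 : 0 < 1 / (s * t * (s + t)) := by positivity
    change g s (s + t) + g (s + t) t ≤ g s t
    linarith
  | succ n ih =>
    intro s t hs ht
    exact add_le_add (ih hs (by positivity)) (ih (by positivity) ht)

noncomputable def Rl (s t : ℝ) : ℝ := ⨅ n, G n s t

lemma Rl_tendsto {s t : ℝ} (hs : 0 < s) (ht : 0 < t) :
    Filter.Tendsto (fun n => G n s t) Filter.atTop (nhds (Rl s t)) :=
  tendsto_atTop_ciInf (antitone_nat_of_succ_le fun n => G_anti_step n hs ht)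
    ⟨0, by rintro _ ⟨n, rfl⟩; exact G_nonneg n hs ht⟩

lemma Rl_nonneg {s t : ℝ} (hs : 0 < s) (ht : 0 < t) : 0 ≤ Rl s t :=
  ge_of_tendsto' (Rl_tendsto hs ht) fun n => G_nonneg n hs ht

lemma Rl_le {s t : ℝ} (hs : 0 < s) (ht : 0 < t) : Rl s t ≤ g s t :=
  ciInf_le (f := fun n => G n s t) ⟨0, by rintro _ ⟨n, rfl⟩; exact G_nonneg n hs ht⟩ 0

lemma Rl_step {s t : ℝ} (hs : 0 < s) (ht : 0 < t) :
    Rl s t = Rl s (s + t) + Rl (s + t) t := by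
  have h1 := (Rl_tendsto hs ht).comp (Filter.tendsto_add_atTop_nat 1)
  have h2 := (Rl_tendsto hs (add_pos hs ht)).add (Rl_tendsto (add_pos hs ht) ht)
  exact tendsto_nhds_unique h1 h2

lemma Rl_le1 {s t : ℝ} (hs : 0 < s) (ht : 0 < t) : Rl s t ≤ 1 / (s * t ^ 2) := by
  have step : ∀ k : ℕ, Rl s t - 1 / (s * t ^ 2) ≤
      Rl s (t + k * s) - 1 / (s * (t + k * s) ^ 2) := by
    intro k
    induction k with
    | zero => simp
    | succ k ih =>
      refine ih.trans ?_
      have hp : 0 < t + k * s := by positivity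
      have e : t + ((k + 1 : ℕ) : ℝ) * s = s + (t + k * s) := by push_cast; ring
      rw [e]
      generalize t + k * s = v at *
      have h1 := Rl_step hs hp
      have h2 := Rl_le (add_pos hs hp) hp
      have h3 : g (s + v) v = 1 / (s * v ^ 2) - 1 / (s * (s + v) ^ 2) := by
        unfold g
        field_simp
        ring
      linarith
  have step2 : ∀ k : ℕ, Rl s t - 1 / (s * t ^ 2) ≤ 1 / (s ^ 2 * (t + k * s)) := by
    intro k
    have h1 := step k
    have h2 := Rl_le hs (show 0 < t + k * s by positivity)
    unfold g at h2
    linarith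
  have lim : Filter.Tendsto (fun k : ℕ => 1 / (s ^ 2 * (t + k * s))) Filter.atTop (nhds 0) := by
    apply Filter.Tendsto.div_atTop tendsto_const_nhds
    apply Filter.Tendsto.const_mul_atTop (by positivity)
    apply Filter.tendsto_atTop_add_const_left
    exact Filter.Tendsto.atTop_mul_const hs tendsto_natCast_atTop_atTop
  have := ge_of_tendsto' lim step2
  linarith

lemma G_symm (n : ℕ) : ∀ s t : ℝ, G n s t = G n t s := by
  induction n with
  | zero =>
    intro s t
    change g s t = g t s
    unfold g
    rw [add_comm, mul_comm s, mul_comm (s ^ 2)]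
  | succ n ih =>
    intro s t
    change G n s (s + t) + G n (s + t) t = G n t (t + s) + G n (t + s) s
    rw [ih s, ih _ t, add_comm s t, add_comm]

lemma Rl_le2 {s t : ℝ} (hs : 0 < s) (ht : 0 < t) : Rl s t ≤ 1 / (s ^ 2 * t) := by
  have h1 : Rl s t = Rl t s := by
    unfold Rl
    simp_rw [G_symm _ s t]
  rw [h1, mul_comm]
  exact Rl_le1 ht hs

lemma Rl_decay (n : ℕ) : ∀ {s t : ℝ}, 1 ≤ s → 1 ≤ t →
    Rl s t ≤ 2 / (s + t + n) * (1 / (s * t)) := by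
  induction n with
  | zero =>
    intro s t hs ht
    have h1 := Rl_le1 (s := s) (t := t) (by linarith) (by linarith)
    have h2 := Rl_le2 (s := s) (t := t) (by linarith) (by linarith)
    have hs0 : 0 < s := by linarith
    have ht0 : 0 < t := by linarith
    rw [le_div_iff₀ (by positivity)] at h1 h2
    rw [Nat.cast_zero, add_zero, div_mul_div_comm, mul_one, le_div_iff₀ (by positivity)]
    nlinarith
  | succ n ih =>
    intro s t hs ht
    have hs0 : 0 < s := by linarith
    have ht0 : 0 < t := by linarith
    rw [Rl_step hs0 ht0]
    have h1 := ih (s := s) (t := s + t) hs (by linarith)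
    have h2 := ih (s := s + t) (t := t) (by linarith) ht
    have h3 : 2 / (s + (s + t) + n) ≤ 2 / (s + t + (n + 1 : ℕ)) := by
      apply div_le_div_of_nonneg_left (by norm_num) (by positivity)
      push_cast; linarith
    have h4 : 2 / (s + t + t + n) ≤ 2 / (s + t + (n + 1 : ℕ)) := by
      apply div_le_div_of_nonneg_left (by norm_num) (by positivity)
      push_cast; linarith
    have e : 1 / (s * t) = 1 / (s * (s + t)) + 1 / ((s + t) * t) := by
      field_simp
      ring
    rw [e, mul_add]
    refine add_le_add (h1.trans ?_) (h2.trans ?_)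
    · exact mul_le_mul_of_nonneg_right h3 (by positivity)
    · exact mul_le_mul_of_nonneg_right h4 (by positivity)

lemma G_tendsto : Filter.Tendsto (fun n => G n 1 1) Filter.atTop (nhds 0) := by
  have h1 := Rl_tendsto (s := 1) (t := 1) one_pos one_pos
  have h0 := Rl_nonneg (s := 1) (t := 1) one_pos one_pos
  have lim : Filter.Tendsto (fun n : ℕ => 2 / ((1 : ℝ) + 1 + n) * (1 / (1 * 1)))
      Filter.atTop (nhds 0) := by
    simp only [mul_one, div_one]
    apply Filter.Tendsto.div_atTop tendsto_const_nhds
    apply Filter.tendsto_atTop_add_const_left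
    exact tendsto_natCast_atTop_atTop
  have h2 := ge_of_tendsto' lim fun n => Rl_decay n (s := 1) (t := 1) le_rfl le_rfl
  rwa [le_antisymm h2 h0] at h1

/-- Unit vector estimate. -/
lemma unit_bound {x y z w : ℝ} (hx : 0 ≤ x) (hy : 0 ≤ y) (hz : 0 ≤ z) (hw : 0 ≤ w)
    (h1 : x ^ 2 + y ^ 2 = 1) (h2 : z ^ 2 + w ^ 2 = 1) :
    |y ^ 3 * z + x ^ 3 * w - z * w| ≤ 2 * (x * w - y * z) ^ 2 := by
  obtain ⟨σ, hσ⟩ : ∃ σ, σ = x * w - y * z := ⟨_, rfl⟩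
  obtain ⟨κ, hκ⟩ : ∃ κ, κ = x * z + y * w := ⟨_, rfl⟩
  have hk : κ ^ 2 + σ ^ 2 = 1 := by
    rw [hκ, hσ]; linear_combination (z ^ 2 + w ^ 2) * h1 + h2
  have hk0 : 0 ≤ κ := by rw [hκ]; positivity
  have hzz : z = x * κ - y * σ := by rw [hκ, hσ]; linear_combination (-z) * h1
  have hww : w = y * κ + x * σ := by rw [hκ, hσ]; linear_combination (-w) * h1
  rw [← hσ]
  have hE : y ^ 3 * z + x ^ 3 * w - z * w =
      x * y * (κ * (1 - κ)) + σ * (x ^ 2 - y ^ 2) * (1 - κ) + x * y * σ ^ 2 := by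
    rw [hzz, hww]
    linear_combination (x * y * κ + σ * (x ^ 2 - y ^ 2)) * h1
  have hk1 : κ ≤ 1 := by nlinarith [sq_nonneg σ]
  have hs1 : |σ| ≤ 1 := by rw [abs_le]; constructor <;> nlinarith [sq_nonneg κ]
  have hd : |x ^ 2 - y ^ 2| ≤ 1 := by
    rw [abs_le]; constructor <;> nlinarith [sq_nonneg x, sq_nonneg y]
  have hxy : x * y ≤ 1 / 2 := by nlinarith [sq_nonneg (x - y)]
  have hxy0 : 0 ≤ x * y := by positivity
  have h1k : 1 - κ ≤ σ ^ 2 := by nlinarith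
  have hm : |σ * (x ^ 2 - y ^ 2)| ≤ 1 := by
    rw [abs_mul]; exact mul_le_one₀ hs1 (abs_nonneg _) hd
  have hm2 : |σ * (x ^ 2 - y ^ 2) * (1 - κ)| ≤ σ ^ 2 := by
    rw [abs_mul, abs_of_nonneg (by linarith : 0 ≤ 1 - κ)]
    nlinarith
  have hkk0 : 0 ≤ κ * (1 - κ) := mul_nonneg hk0 (by linarith)
  have hkk : κ * (1 - κ) ≤ σ ^ 2 := by nlinarith
  have ha : 0 ≤ x * y * (κ * (1 - κ)) := mul_nonneg hxy0 hkk0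
  have hb : x * y * (κ * (1 - κ)) ≤ 1 / 2 * σ ^ 2 :=
    mul_le_mul hxy hkk hkk0 (by norm_num)
  have hc : 0 ≤ x * y * σ ^ 2 := by positivity
  have hc' : x * y * σ ^ 2 ≤ 1 / 2 * σ ^ 2 := mul_le_mul_of_nonneg_right hxy (sq_nonneg _)
  rw [hE]
  rw [abs_le] at hm2 ⊢
  constructor <;> nlinarith [sq_nonneg σ, hm2.1, hm2.2]

noncomputable def hr (a b : ℝ) : ℝ := a * b / Real.sqrt (a ^ 2 + b ^ 2)

/-- Pairing of the gradient of `hr` at `(a, b)` with `(c, d)`. -/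
noncomputable def gd (a b c d : ℝ) : ℝ :=
  (b ^ 3 * c + a ^ 3 * d) / Real.sqrt (a ^ 2 + b ^ 2) ^ 3

lemma gd_add (a b c d c' d' : ℝ) : gd a b (c + c') (d + d') = gd a b c d + gd a b c' d' := by
  unfold gd; ring

lemma gd_self {a b : ℝ} (hab : 0 < a ^ 2 + b ^ 2) : gd a b a b = hr a b := by
  unfold gd hr
  have h1 := Real.sq_sqrt hab.le
  have h2 := Real.sqrt_pos.2 hab
  generalize Real.sqrt (a ^ 2 + b ^ 2) = p at *
  rw [div_eq_div_iff (by positivity) (by positivity)]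
  linear_combination (-(a * b * p)) * h1

lemma gd_bound {a b c d : ℝ} (ha : 0 ≤ a) (hb : 0 ≤ b) (hc : 0 ≤ c) (hd : 0 ≤ d)
    (hdet : (a * d - b * c) ^ 2 = 1) (hs : 0 < a + b) (ht : 0 < c + d) :
    |gd a b c d - hr c d| ≤ 8 / ((a + b) ^ 2 * (c + d)) := by
  have hab : 0 < a ^ 2 + b ^ 2 := by nlinarith [sq_nonneg (a - b), mul_pos hs hs]
  have hcd : 0 < c ^ 2 + d ^ 2 := by nlinarith [sq_nonneg (c - d), mul_pos ht ht]
  unfold gd hr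
  have hp2 := Real.sq_sqrt hab.le
  have hp := Real.sqrt_pos.2 hab
  have hq2 := Real.sq_sqrt hcd.le
  have hq := Real.sqrt_pos.2 hcd
  generalize Real.sqrt (a ^ 2 + b ^ 2) = p at *
  generalize Real.sqrt (c ^ 2 + d ^ 2) = q at *
  have key := unit_bound (x := a / p) (y := b / p) (z := c / q) (w := d / q)
    (by positivity) (by positivity) (by positivity) (by positivity)
    (by rw [div_pow, div_pow, ← add_div, ← hp2]; exact div_self (by positivity))
    (by rw [div_pow, div_pow, ← add_div, ← hq2]; exact div_self (by positivity))
  have e1 : (b ^ 3 * c + a ^ 3 * d) / p ^ 3 - c * d / q =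
      q * ((b / p) ^ 3 * (c / q) + (a / p) ^ 3 * (d / q) - c / q * (d / q)) := by
    field_simp
  have e2 : (a / p * (d / q) - b / p * (c / q)) ^ 2 = 1 / (p ^ 2 * q ^ 2) := by
    rw [← hdet]
    field_simp
  rw [e2] at key
  rw [e1, abs_mul, abs_of_pos hq]
  calc _ ≤ q * (2 * (1 / (p ^ 2 * q ^ 2))) := mul_le_mul_of_nonneg_left key hq.le
    _ = 2 / (p ^ 2 * q) := by field_simp
    _ ≤ _ := by
      have i1 : (a + b) ^ 2 ≤ 2 * p ^ 2 := by nlinarith [sq_nonneg (a - b)]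
      have i2 : c + d ≤ 2 * q := by
        refine abs_le_of_sq_le_sq' ?_ (by positivity) |>.2
        nlinarith [sq_nonneg (c - d)]
      rw [div_le_div_iff₀ (by positivity) (by positivity)]
      have := mul_le_mul i1 i2 ht.le (by positivity)
      nlinarith

noncomputable def P (x : X) : ℝ :=
  (gd x.1.1 x.1.2.1 x.1.2.2.1 x.1.2.2.2 - hr x.1.2.2.1 x.1.2.2.2) +
  (gd x.1.2.2.1 x.1.2.2.2 x.1.1 x.1.2.1 - hr x.1.1 x.1.2.1)

noncomputable def dl (x : X) : ℝ :=
  h (x.1.1 + x.1.2.2.1) (x.1.2.1 + x.1.2.2.2) - h x.1.1 x.1.2.1 - h x.1.2.2.1 x.1.2.2.2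

lemma sq_pos_aux {a b : ℕ} (hab : 1 ≤ a + b) : 0 < (a : ℝ) ^ 2 + (b : ℝ) ^ 2 := by
  have : (1 : ℝ) ≤ a + b := by exact_mod_cast hab
  nlinarith [sq_nonneg ((a : ℝ) - b)]

lemma P_step (x : X) : P x - (P (L x) + P (R x)) = dl x := by
  have hs := s_pos x
  have ht := t_pos x
  obtain ⟨⟨a, b, c, d⟩, h1, h2⟩ := x
  simp only [s, t] at hs ht
  have e1 := gd_self (sq_pos_aux hs)
  have e2 := gd_self (sq_pos_aux ht)
  have e3 := gd_self (sq_pos_aux (show 1 ≤ (a + c) + (b + d) by omega))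
  simp only [P, dl, L, R]
  change _ = hr _ _ - hr _ _ - hr _ _
  push_cast at *
  simp only [gd_add] at *
  linarith

lemma det_real (x : X) :
    (x.1.1 : ℝ) * x.1.2.2.2 - x.1.2.1 * x.1.2.2.1 = 1 := by
  have : (x.1.1 : ℝ) * x.1.2.2.2 = x.1.2.1 * x.1.2.2.1 + 1 := by exact_mod_cast x.2.2
  linarith

lemma P_bound (x : X) : |P x| ≤ 8 * g (s x) (t x) := by
  have hs := s_pos x
  have ht := t_pos x
  have hdet := det_real x
  obtain ⟨⟨a, b, c, d⟩, h1, h2⟩ := x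
  simp only [s, t] at *
  have hs' : (1 : ℝ) ≤ a + b := by exact_mod_cast hs
  have ht' : (1 : ℝ) ≤ c + d := by exact_mod_cast ht
  have b1 := gd_bound (a := a) (b := b) (c := c) (d := d) (by positivity) (by positivity)
    (by positivity) (by positivity) (by rw [hdet]; norm_num) (by linarith) (by linarith)
  have b2 := gd_bound (a := c) (b := d) (c := a) (d := b) (by positivity) (by positivity)
    (by positivity) (by positivity)
    (by linear_combination ((a : ℝ) * d - b * c + 1) * hdet) (by linarith) (by linarith)
  simp only [P]
  refine (abs_add_le _ _).trans ((add_le_add b1 b2).trans (le_of_eq ?_))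
  unfold g
  push_cast
  rw [mul_comm ((c + d : ℝ) ^ 2)]
  ring

lemma dl_bound (x : X) :
    |dl x| ≤ 8 * (g (s x) (t x) - (g (s (L x)) (t (L x)) + g (s (R x)) (t (R x)))) := by
  have hs := s_pos x
  have ht := t_pos x
  have hdet := det_real x
  rw [sL, tL, sR, tR, Nat.cast_add, g_step (by exact_mod_cast hs) (by exact_mod_cast ht)]
  obtain ⟨⟨a, b, c, d⟩, h1, h2⟩ := x
  simp only [s, t] at *
  have hs' : (1 : ℝ) ≤ a + b := by exact_mod_cast hs
  have ht' : (1 : ℝ) ≤ c + d := by exact_mod_cast ht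
  have b1 := gd_bound (a := a + c) (b := b + d) (c := c) (d := d) (by positivity) (by positivity)
    (by positivity) (by positivity)
    (by linear_combination ((a : ℝ) * d - b * c + 1) * hdet) (by linarith) (by linarith)
  have b2 := gd_bound (a := a + c) (b := b + d) (c := a) (d := b) (by positivity) (by positivity)
    (by positivity) (by positivity)
    (by linear_combination ((a : ℝ) * d - b * c + 1) * hdet) (by linarith) (by linarith)
  have e3 := gd_self (sq_pos_aux (show 1 ≤ (a + c) + (b + d) by omega))
  have e : dl ⟨(a, b, c, d), h1, h2⟩ = (gd (a + c) (b + d) c d - hr c d) +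
      (gd (a + c) (b + d) a b - hr a b) := by
    simp only [dl]
    change hr _ _ - hr _ _ - hr _ _ = _
    rw [← e3]
    push_cast
    rw [gd_add]
    ring
  rw [e]
  refine (abs_add_le _ _).trans ((add_le_add b1 b2).trans (le_of_eq ?_))
  push_cast
  have e4 : (a + c + (b + d) : ℝ) = (a + b) + (c + d) := by ring
  rw [e4]
  generalize (a + b : ℝ) = u at *
  generalize (c + d : ℝ) = v at *
  field_simp

lemma T_bound (n : ℕ) : ∀ x : X, |T n P x| ≤ 8 * G n (s x) (t x) := by
  induction n with
  | zero => exact P_bound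
  | succ n ih =>
    intro x
    have h1 := ih (L x)
    have h2 := ih (R x)
    rw [sL, tL, Nat.cast_add] at h1
    rw [sR, tR, Nat.cast_add] at h2
    change |T n P (L x) + T n P (R x)| ≤ 8 * (G n _ _ + G n _ _)
    refine (abs_add_le _ _).trans ?_
    linarith

lemma T_g_nonneg (n : ℕ) : ∀ x : X, 0 ≤ T n (fun x => g (s x) (t x)) x := by
  induction n with
  | zero => intro x; simp only [T, g]; positivity
  | succ n ih => intro x; exact add_nonneg (ih _) (ih _)

lemma dl_summable : Summable dl := by
  apply Summable.of_abs
  refine summable_of_sum_le (c := 16) (fun _ => abs_nonneg _) fun u => ?_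
  obtain ⟨n, hn⟩ := (S_tendsto.eventually (Filter.eventually_ge_atTop u)).exists
  calc _ ≤ ∑ x ∈ S n, |dl x| :=
        Finset.sum_le_sum_of_subset_of_nonneg hn fun _ _ _ => abs_nonneg _
    _ ≤ ∑ x ∈ S n, 8 * (g (s x) (t x) - (g (s (L x)) (t (L x)) + g (s (R x)) (t (R x)))) :=
        Finset.sum_le_sum fun x _ => dl_bound x
    _ = 8 * (g (s I) (t I) - T n (fun x => g (s x) (t x)) I) := by
        rw [← Finset.mul_sum, telescope n (fun x => g (s x) (t x))]
    _ ≤ 16 := by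
        have := T_g_nonneg n I
        have e : g (s I) (t I) = 2 := by
          have e1 : s I = 1 := rfl
          have e2 : t I = 1 := rfl
          rw [e1, e2]; norm_num [g]
        linarith

lemma P_I : P I = 2 := by
  norm_num [P, I, gd, hr]

lemma dl_hasSum : HasSum dl 2 := by
  have h1 := dl_summable.hasSum
  have h2 : Filter.Tendsto (fun n => ∑ x ∈ S n, dl x) Filter.atTop (nhds 2) := by
    have e : (fun n => ∑ x ∈ S n, dl x) = fun n => 2 - T n P I := by
      funext n
      rw [← P_I, ← telescope n P]
      exact Finset.sum_congr rfl fun x _ => (P_step x).symm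
    rw [e]
    have h3 : Filter.Tendsto (fun n => T n P I) Filter.atTop (nhds 0) := by
      have h4 := G_tendsto.const_mul 8
      rw [mul_zero] at h4
      refine squeeze_zero_norm (fun n => ?_) h4
      have := T_bound n I
      have e1 : s I = 1 := rfl
      have e2 : t I = 1 := rfl
      rw [e1, e2, Nat.cast_one] at this
      exact this
    simpa using h3.const_sub 2
  have h5 := tendsto_nhds_unique (h1.comp S_tendsto) h2
  rwa [h5] at h1

end Astroid

theorem sum_astroid_linear :
    HasSum (fun x : {x : ℕ × ℕ × ℕ × ℕ //
        1 ≤ x.1 ∧ x.1 * x.2.2.2 = x.2.1 * x.2.2.1 + 1} =>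
      h x.val.1 x.val.2.1 + h x.val.2.2.1 x.val.2.2.2 -
        h (x.val.1 + x.val.2.2.1) (x.val.2.1 + x.val.2.2.2)) (-2) := by
  have := Astroid.dl_hasSum.neg
  have e : (fun x => -Astroid.dl x) = (fun x : Astroid.X =>
      h x.val.1 x.val.2.1 + h x.val.2.2.1 x.val.2.2.2 -
        h (x.val.1 + x.val.2.2.1) (x.val.2.1 + x.val.2.2.2)) := by
    funext x
    unfold Astroid.dl
    ring
  rw [e] at this
  exact this
end
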